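/- The single-piece decomposition does not preserve sometimes-termination of the restricted chase: there exists a rule set 𝓡 such that 𝓡 ∈ CT_R^∃ (every knowledge base ⟨𝓡,F⟩ admits some terminating R-derivation) but sp(𝓡) ∉ CT_R^∃ (some knowledge base ⟨sp(𝓡),F⟩ admits no terminating R-derivation). -/

import Mathlib

namespace ExRules

open scoped Classical

noncomputable section

/-- Terms: constants or variables, each indexed by a natural number. -/
inductive Term where
  | const : ℕ → Term
  | var : ℕ → Term
deriving DecidableEq

/-- An atom: a predicate symbol applied to a list of terms (the arity of the
predicate is the length of the argument list). -/
structure Atom where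
  pred : ℕ
  args : List Term
deriving DecidableEq

/-- A factbase is a finite set of atoms. -/
abbrev FactBase := Finset Atom

/-- A substitution: a map on variables (extended by the identity on constants). -/
abbrev Subst := ℕ → Term

def applyTerm (σ : Subst) : Term → Term
  | .const c => .const c
  | .var v => σ v

def Atom.subst (σ : Subst) (a : Atom) : Atom := ⟨a.pred, a.args.map (applyTerm σ)⟩

def Term.vars : Term → Finset ℕ
  | .const _ => ∅
  | .var v => {v}

def Atom.vars (a : Atom) : Finset ℕ := a.args.foldr (fun t s => t.vars ∪ s) ∅

def FactBase.vars (F : FactBase) : Finset ℕ := F.sup Atom.vars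

/-- The variables occurring in a (possibly infinite) set of atoms. -/
def setVars (S : Set Atom) : Set ℕ := {v | ∃ a ∈ S, v ∈ a.vars}

/-- `σ` is a homomorphism from the atom set `S` to the atom set `S'`. -/
def IsHom (σ : Subst) (S S' : Set Atom) : Prop := ∀ a ∈ S, a.subst σ ∈ S'

/-- A retraction is a homomorphism that is the identity on the common variables. -/
def IsRetraction (σ : Subst) (S S' : Set Atom) : Prop :=
  IsHom σ S S' ∧ ∀ v, v ∈ setVars S → v ∈ setVars S' → σ v = Term.var v

/-- An existential rule `B → ∃z.H` with nonempty body and head.  The frontier and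
the existential variables are determined by the variables shared between body and
head. -/
structure Rule where
  body : Finset Atom
  head : Finset Atom
  body_nonempty : body.Nonempty
  head_nonempty : head.Nonempty

instance : DecidableEq Rule := fun R S =>
  decidable_of_iff (R.body = S.body ∧ R.head = S.head) (by
    constructor
    · rintro ⟨h1, h2⟩
      cases R; cases S; simp_all
    · rintro rfl; exact ⟨rfl, rfl⟩)

/-- The frontier of a rule: the variables shared by body and head. -/
def Rule.frontier (R : Rule) : Finset ℕ := FactBase.vars R.body ∩ FactBase.vars R.head

/-- The existential variables of a rule: head variables not occurring in the body. -/
def Rule.exVars (R : Rule) : Finset ℕ := FactBase.vars R.head \ FactBase.vars R.body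

/-- A rule is Datalog if it has no existential variable. -/
def Rule.IsDatalog (R : Rule) : Prop := R.exVars = ∅

/-- A rule has an atomic head if its head is a single atom. -/
def Rule.IsAtomicHead (R : Rule) : Prop := R.head.card = 1

/-- A rule set is a finite set of existential rules. -/
abbrev RuleSet := Finset Rule

instance : Encodable Term :=
  Encodable.ofEquiv (ℕ ⊕ ℕ)
    { toFun := fun t => match t with | .const c => .inl c | .var v => .inr v
      invFun := fun s => match s with | .inl c => .const c | .inr v => .var v
      left_inv := by intro t; cases t <;> rfl
      right_inv := by intro s; cases s <;> rfl }

instance : Encodable Atom :=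
  Encodable.ofEquiv (ℕ × List Term)
    { toFun := fun a => (a.pred, a.args)
      invFun := fun p => ⟨p.1, p.2⟩
      left_inv := fun _ => rfl
      right_inv := fun _ => rfl }

instance : Encodable Rule :=
  Encodable.ofEquiv {p : Finset Atom × Finset Atom // p.1.Nonempty ∧ p.2.Nonempty}
    { toFun := fun R => ⟨(R.body, R.head), R.body_nonempty, R.head_nonempty⟩
      invFun := fun p => ⟨p.1.1, p.1.2, p.2.1, p.2.2⟩
      left_inv := fun _ => rfl
      right_inv := fun _ => rfl }

/-- A trigger `(R, π)`: a rule together with a substitution. -/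
structure Trigger where
  rule : Rule
  map : Subst

/-- The canonical fresh variable `z_t` associated to a trigger `t` and an
existential variable `z`: it is unique for `z` and (the relevant part of) `t`. -/
def Trigger.freshVar (t : Trigger) (z : ℕ) : ℕ :=
  Nat.pair
    (Encodable.encode (t.rule, ((FactBase.vars t.rule.body).sort (· ≤ ·)).map t.map)) z

/-- The extension `π_R` of the substitution of a trigger, mapping each existential
variable `z` to the fresh variable `z_t`. -/
def Trigger.ext (t : Trigger) : Subst := fun v =>
  if v ∈ t.rule.exVars then Term.var (t.freshVar v) else t.map v

/-- The output of a trigger: `out(t) = π_R(H)`. -/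
def Trigger.out (t : Trigger) : Finset Atom := t.rule.head.image (Atom.subst t.ext)

/-- `t` is a trigger on the factbase `F`: its substitution is a homomorphism from
the body of its rule to `F`. -/
def Trigger.IsOn (t : Trigger) (F : FactBase) : Prop := IsHom t.map ↑t.rule.body ↑F

/-- The chase variants: oblivious, semi-oblivious, restricted, equivalent. -/
inductive Variant where
  | O | SO | R | E

/-- Applicability of a trigger on a factbase, for each chase variant. -/
def Applicable : Variant → Trigger → FactBase → Prop
  | .O, t, F => ¬ t.out ⊆ F
  | .SO, t, F => ∀ t' : Trigger, t'.rule = t.rule →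
      (∀ v ∈ t.rule.frontier, t'.map v = t.map v) → ¬ t'.out ⊆ F
  | .R, t, F => ¬ ∃ σ : Subst, IsRetraction σ ↑(F ∪ t.out) ↑F
  | .E, t, F => ¬ ∃ σ : Subst, IsHom σ ↑(F ∪ t.out) ↑F

/-- An atom set `M` satisfies a rule `B → ∃z.H` if every homomorphism from `B`
to `M` extends to a homomorphism mapping `H` into `M`. -/
def SatisfiesRule (M : Set Atom) (R : Rule) : Prop :=
  ∀ σ : Subst, IsHom σ ↑R.body M →
    ∃ σ' : Subst, (∀ v ∈ FactBase.vars R.body, σ' v = σ v) ∧ IsHom σ' ↑R.head M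

/-- A (finite or infinite) derivation from the knowledge base `⟨𝓡, F⟩`:
`len` is the number of triggers (possibly `⊤`), `fb i` is the `i`-th factbase and,
for `i < len`, `tr i` is the trigger producing `fb (i+1)` from `fb i`. -/
structure Derivation (𝓡 : RuleSet) (F : FactBase) where
  len : ℕ∞
  fb : ℕ → FactBase
  tr : ℕ → Trigger
  fb_zero : fb 0 = F
  rule_mem : ∀ i : ℕ, (i : ℕ∞) < len → (tr i).rule ∈ 𝓡
  trig_on : ∀ i : ℕ, (i : ℕ∞) < len → (tr i).IsOn (fb i)
  trig_new : ∀ i : ℕ, (i : ℕ∞) < len → ¬ (tr i).out ⊆ fb i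
  fb_succ : ∀ i : ℕ, (i : ℕ∞) < len → fb (i + 1) = fb i ∪ (tr i).out
  fb_stall : ∀ i : ℕ, ¬ (i : ℕ∞) < len → fb (i + 1) = fb i

namespace Derivation

variable {𝓡 : RuleSet} {F : FactBase}

/-- An `X`-derivation: every applied trigger is `X`-applicable when applied. -/
def IsX (X : Variant) (D : Derivation 𝓡 F) : Prop :=
  ∀ i : ℕ, (i : ℕ∞) < D.len → Applicable X (D.tr i) (D.fb i)

/-- Datalog-first: a non-Datalog rule is only applied when all Datalog rules of
the rule set are satisfied. -/
def DatalogFirst (D : Derivation 𝓡 F) : Prop :=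
  ∀ i : ℕ, (i : ℕ∞) < D.len → ¬ (D.tr i).rule.IsDatalog →
    ∀ R ∈ 𝓡, R.IsDatalog → SatisfiesRule ↑(D.fb i) R

/-- Fairness: every trigger `X`-applicable on some factbase of the derivation is
eventually not `X`-applicable. -/
def Fair (X : Variant) (D : Derivation 𝓡 F) : Prop :=
  ∀ i : ℕ, (i : ℕ∞) ≤ D.len → ∀ t : Trigger, t.rule ∈ 𝓡 → t.IsOn (D.fb i) →
    Applicable X t (D.fb i) →
    ∃ j : ℕ, i < j ∧ (j : ℕ∞) ≤ D.len ∧ ¬ Applicable X t (D.fb j)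

/-- A derivation is finite if its length is not `⊤`. -/
def Finite (D : Derivation 𝓡 F) : Prop := D.len ≠ ⊤

end Derivation

/-- `CT_X^∀` (non-Datalog-first): every fair `X`-derivation from every KB is finite. -/
def CTall (X : Variant) (𝓡 : RuleSet) : Prop :=
  ∀ F : FactBase, ∀ D : Derivation 𝓡 F, D.IsX X → D.Fair X → D.Finite

/-- `CT_X^∃`: some fair `X`-derivation from every KB is finite. -/
def CTex (X : Variant) (𝓡 : RuleSet) : Prop :=
  ∀ F : FactBase, ∃ D : Derivation 𝓡 F, D.IsX X ∧ D.Fair X ∧ D.Finite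

/-- `CT_{df-X}^∀`: every fair Datalog-first `X`-derivation from every KB is finite. -/
def CTallDF (X : Variant) (𝓡 : RuleSet) : Prop :=
  ∀ F : FactBase, ∀ D : Derivation 𝓡 F, D.IsX X → D.DatalogFirst → D.Fair X → D.Finite

/-- `CT_{df-X}^∃`: some fair Datalog-first `X`-derivation from every KB is finite. -/
def CTexDF (X : Variant) (𝓡 : RuleSet) : Prop :=
  ∀ F : FactBase, ∃ D : Derivation 𝓡 F, D.IsX X ∧ D.DatalogFirst ∧ D.Fair X ∧ D.Finite

/-! ### Single-piece decomposition -/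

/-- Adjacency in the piece graph of a rule: two head atoms sharing an existential
variable. -/
def PieceAdj (R : Rule) (a b : Atom) : Prop :=
  a ∈ R.head ∧ b ∈ R.head ∧ (a.vars ∩ b.vars ∩ R.exVars).Nonempty

/-- The piece (connected component of the piece graph) containing a given head atom. -/
def pieceOf (R : Rule) (a : Atom) : Finset Atom :=
  R.head.filter fun b => Relation.ReflTransGen (PieceAdj R) a b

theorem self_mem_pieceOf {R : Rule} {a : Atom} (h : a ∈ R.head) : a ∈ pieceOf R a := by
  rw [pieceOf, Finset.mem_filter]
  exact ⟨h, Relation.ReflTransGen.refl⟩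

/-- The single-piece decomposition of a rule. -/
def Rule.sp (R : Rule) : Finset Rule :=
  R.head.attach.image fun a =>
    ⟨R.body, pieceOf R a.1, R.body_nonempty, ⟨a.1, self_mem_pieceOf a.2⟩⟩

/-- The single-piece decomposition of a rule set. -/
def spSet (𝓡 : RuleSet) : RuleSet := 𝓡.biUnion Rule.sp

/-! ### Atomic decompositions -/

/-- The predicates occurring in a rule set. -/
def RuleSet.predsF (𝓡 : RuleSet) : Finset ℕ :=
  𝓡.sup fun R => (R.body.image Atom.pred) ∪ (R.head.image Atom.pred)

/-- A fresh predicate `X_R`, unique for `R` and not occurring in `𝓡`. -/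
def freshPred (𝓡 : RuleSet) (R : Rule) : ℕ :=
  (RuleSet.predsF 𝓡).sup id + 1 + Encodable.encode R

/-- The atom `X_R(x, z)` over the fresh predicate, whose arguments are the frontier
variables followed by the existential variables of `R`. -/
def xAtom (𝓡 : RuleSet) (R : Rule) : Atom :=
  ⟨freshPred 𝓡 R,
    ((R.frontier.sort (· ≤ ·)).map Term.var) ++ ((R.exVars.sort (· ≤ ·)).map Term.var)⟩

/-- The one-way atomic decomposition of a rule `R = B → ∃z.H` (relative to `𝓡`):
the rule `B → ∃z.X_R(x,z)` together with a rule `X_R(x,z) → P(t)` for each head atom. -/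
def oneAdRule (𝓡 : RuleSet) (R : Rule) : Finset Rule :=
  insert ⟨R.body, {xAtom 𝓡 R}, R.body_nonempty, Finset.singleton_nonempty _⟩
    (R.head.attach.image fun a =>
      ⟨{xAtom 𝓡 R}, {a.1}, Finset.singleton_nonempty _, Finset.singleton_nonempty _⟩)

/-- The one-way atomic decomposition of a rule set. -/
def oneAd (𝓡 : RuleSet) : RuleSet := 𝓡.biUnion (oneAdRule 𝓡)

/-- The two-way atomic decomposition: `2ad(R) = 1ad(R) ∪ {H[x,z] → X_R(x,z)}`. -/
def twoAd (𝓡 : RuleSet) : RuleSet :=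
  oneAd 𝓡 ∪ 𝓡.image fun R =>
    ⟨R.head, {xAtom 𝓡 R}, R.head_nonempty, Finset.singleton_nonempty _⟩

/-! ### Models, entailment, BDDP -/

/-- `M` is a model of the rule set `𝓡`. -/
def IsModelOfRules (𝓡 : RuleSet) (M : Set Atom) : Prop := ∀ R ∈ 𝓡, SatisfiesRule M R

/-- `M` is a model of the knowledge base `⟨𝓡, F⟩`. -/
def IsModelOfKB (𝓡 : RuleSet) (F : FactBase) (M : Set Atom) : Prop :=
  IsModelOfRules 𝓡 M ∧ ∃ σ : Subst, IsHom σ ↑F M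

/-- `M` is a universal model of `⟨𝓡, F⟩`: a model mapping homomorphically into
every model. -/
def IsUniversalModel (𝓡 : RuleSet) (F : FactBase) (M : Set Atom) : Prop :=
  IsModelOfKB 𝓡 F M ∧ ∀ N : Set Atom, IsModelOfKB 𝓡 F N → ∃ σ : Subst, IsHom σ M N

/-- An atom set entails a Boolean conjunctive query `Q` if `Q` maps
homomorphically into it. -/
def EntailsQ (S : Set Atom) (Q : Finset Atom) : Prop := ∃ σ : Subst, IsHom σ ↑Q S

/-- `⟨𝓡, F⟩ ⊨ Q`: every model of the KB entails `Q`. -/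
def KBEntails (𝓡 : RuleSet) (F : FactBase) (Q : Finset Atom) : Prop :=
  ∀ M : Set Atom, IsModelOfKB 𝓡 F M → EntailsQ M Q

/-- `R(F)`: the minimal atom set including `F` and `out(t)` for every trigger `t`
with rule `R` on `F`. -/
def ruleStep (R : Rule) (S : Set Atom) : Set Atom :=
  S ∪ {a | ∃ t : Trigger, t.rule = R ∧ IsHom t.map ↑R.body S ∧ a ∈ t.out}

/-- `𝓡(F) = ⋃_{R ∈ 𝓡} R(F)` (together with `F`). -/
def setStep (𝓡 : RuleSet) (S : Set Atom) : Set Atom := S ∪ ⋃ R ∈ 𝓡, ruleStep R S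

/-- The breadth-first chase `Ch_i(⟨𝓡, F⟩)`. -/
def ch (𝓡 : RuleSet) (F : FactBase) : ℕ → Set Atom
  | 0 => ↑F
  | i + 1 => setStep 𝓡 (ch 𝓡 F i)

/-- The bounded derivation depth property. -/
def BDDP (𝓡 : RuleSet) : Prop :=
  ∀ Q : Finset Atom, ∃ k : ℕ, ∀ F : FactBase, KBEntails 𝓡 F Q ↔ EntailsQ (ch 𝓡 F k) Q

/-! ### Conservative extensions -/

/-- The restriction of an atom set to the atoms over a given set of predicates. -/
def restrictTo (M : Set Atom) (P : Set ℕ) : Set Atom := {a ∈ M | a.pred ∈ P}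

/-- The terms (domain elements) of an atom set. -/
def termsOf (M : Set Atom) : Set Term := {u | ∃ a ∈ M, u ∈ a.args}

/-- `𝓡'` is a conservative extension of `𝓡`. -/
def ConservativeExt (𝓡 𝓡' : RuleSet) : Prop :=
  (↑(RuleSet.predsF 𝓡) : Set ℕ) ⊆ ↑(RuleSet.predsF 𝓡') ∧
  (∀ M : Set Atom, IsModelOfRules 𝓡' M →
    IsModelOfRules 𝓡 (restrictTo M ↑(RuleSet.predsF 𝓡))) ∧
  (∀ M : Set Atom, IsModelOfRules 𝓡 M →
    ∃ M' : Set Atom, M ⊆ M' ∧ IsModelOfRules 𝓡' M' ∧ termsOf M' = termsOf M ∧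
      restrictTo M' ↑(RuleSet.predsF 𝓡) = restrictTo M ↑(RuleSet.predsF 𝓡))

/-- `𝓡'` is a universal-conservative extension of `𝓡`. -/
def UnivConservativeExt (𝓡 𝓡' : RuleSet) : Prop :=
  (↑(RuleSet.predsF 𝓡) : Set ℕ) ⊆ ↑(RuleSet.predsF 𝓡') ∧
  ∀ F : FactBase, (∀ a ∈ F, a.pred ∈ RuleSet.predsF 𝓡) →
    (∀ M : Set Atom, IsUniversalModel 𝓡' F M →
      IsUniversalModel 𝓡 F (restrictTo M ↑(RuleSet.predsF 𝓡))) ∧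
    (∀ M : Set Atom, IsUniversalModel 𝓡 F M →
      ∃ M' : Set Atom, M ⊆ M' ∧ IsUniversalModel 𝓡' F M' ∧ termsOf M' = termsOf M ∧
        restrictTo M' ↑(RuleSet.predsF 𝓡) = restrictTo M ↑(RuleSet.predsF 𝓡))

/-! ### Substitutions and variables -/

theorem Term.mem_vars {t : Term} {v : ℕ} : v ∈ t.vars ↔ t = Term.var v := by
  cases t <;> simp [Term.vars, eq_comm]

theorem Atom.mem_vars {a : Atom} {v : ℕ} : v ∈ a.vars ↔ Term.var v ∈ a.args := by
  obtain ⟨p, l⟩ := a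
  simp only [Atom.vars]
  induction l with
  | nil => simp
  | cons t l ih => simp [ih, Term.mem_vars, eq_comm]

theorem FactBase.mem_vars {F : FactBase} {v : ℕ} :
    v ∈ FactBase.vars F ↔ ∃ a ∈ F, Term.var v ∈ a.args := by
  simp [FactBase.vars, Finset.mem_sup, Atom.mem_vars]

theorem FactBase.vars_mono {F G : FactBase} (h : F ⊆ G) :
    FactBase.vars F ⊆ FactBase.vars G := Finset.sup_mono h

theorem mem_setVars_coe {F : FactBase} {v : ℕ} :
    v ∈ setVars (↑F : Set Atom) ↔ v ∈ FactBase.vars F := by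
  simp [setVars, FactBase.mem_vars, Atom.mem_vars]

theorem Rule.mem_exVars {R : Rule} {v : ℕ} :
    v ∈ R.exVars ↔ v ∈ FactBase.vars R.head ∧ v ∉ FactBase.vars R.body := by
  simp [Rule.exVars]

theorem Atom.subst_congr {σ τ : Subst} {a : Atom}
    (h : ∀ v, Term.var v ∈ a.args → σ v = τ v) : a.subst σ = a.subst τ := by
  simp only [Atom.subst, Atom.mk.injEq, true_and]
  refine List.map_congr_left fun t ht => ?_
  cases t with
  | const c => rfl
  | var v => exact h v ht

theorem Atom.subst_subst (σ τ : Subst) (a : Atom) :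
    (a.subst σ).subst τ = a.subst fun v => applyTerm τ (σ v) := by
  simp only [Atom.subst, List.map_map, Atom.mk.injEq, true_and]
  refine List.map_congr_left fun t _ => ?_
  cases t <;> rfl

theorem applyTerm_var (t : Term) : applyTerm Term.var t = t := by cases t <;> rfl

theorem Atom.subst_eq_self {σ : Subst} {a : Atom}
    (h : ∀ v, Term.var v ∈ a.args → σ v = Term.var v) : a.subst σ = a := by
  rw [Atom.subst_congr (τ := Term.var) h]
  obtain ⟨p, l⟩ := a
  simp only [Atom.subst, Atom.mk.injEq, true_and]
  exact (List.map_congr_left fun t _ => applyTerm_var t).trans (List.map_id' l)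

theorem Atom.mem_subst_args {σ : Subst} {a : Atom} {v : ℕ} (h : Term.var v ∈ a.args) :
    σ v ∈ (a.subst σ).args := List.mem_map.2 ⟨_, h, rfl⟩

/-! ### Triggers -/

theorem Trigger.ext_of_mem_body {t : Trigger} {v : ℕ} (h : v ∈ FactBase.vars t.rule.body) :
    t.ext v = t.map v := by
  simp [Trigger.ext, Rule.mem_exVars, h]

theorem Trigger.ext_of_mem_exVars {t : Trigger} {v : ℕ} (h : v ∈ t.rule.exVars) :
    t.ext v = Term.var (t.freshVar v) := by
  simp [Trigger.ext, h]

theorem Trigger.freshVar_injective {t t' : Trigger} {z z' : ℕ}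
    (h : t.freshVar z = t'.freshVar z') :
    t.rule = t'.rule ∧ (∀ v ∈ FactBase.vars t.rule.body, t.map v = t'.map v) ∧ z = z' := by
  obtain ⟨h1, h2⟩ := Nat.pair_eq_pair.1 h
  have h3 := Encodable.encode_injective h1
  obtain ⟨h4, h5⟩ := Prod.mk.injEq .. ▸ h3
  refine ⟨h4, fun v hv => ?_, h2⟩
  rw [← h4] at h5
  exact List.map_inj_left.1 h5 v ((Finset.mem_sort _).2 hv)

theorem Trigger.out_eq_of_freshVar_eq {t t' : Trigger} {z z' : ℕ}
    (h : t.freshVar z = t'.freshVar z') : t.out = t'.out := by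
  obtain ⟨hr, hm, -⟩ := Trigger.freshVar_injective h
  have hf : ∀ v, t.freshVar v = t'.freshVar v := fun v =>
    Nat.pair_eq_pair.2 ⟨(Nat.pair_eq_pair.1 h).1, rfl⟩
  rw [Trigger.out, Trigger.out, ← hr]
  refine Finset.image_congr fun a ha => Atom.subst_congr fun v hv => ?_
  by_cases hx : v ∈ t.rule.exVars
  · rw [Trigger.ext_of_mem_exVars hx, Trigger.ext_of_mem_exVars (hr ▸ hx), hf]
  · have hb : v ∈ FactBase.vars t.rule.body := by
      by_contra hb
      exact hx (Rule.mem_exVars.2 ⟨FactBase.mem_vars.2 ⟨a, ha, hv⟩, hb⟩)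
    rw [Trigger.ext_of_mem_body hb, Trigger.ext_of_mem_body (hr ▸ hb), hm v hb]

theorem Trigger.IsOn.mem_vars {t : Trigger} {F : FactBase} (h : t.IsOn F) {y v : ℕ}
    (hy : y ∈ FactBase.vars t.rule.body) (hv : t.map y = Term.var v) : v ∈ FactBase.vars F := by
  obtain ⟨b, hb, hyb⟩ := FactBase.mem_vars.1 hy
  exact FactBase.mem_vars.2 ⟨_, h b hb, hv ▸ Atom.mem_subst_args hyb⟩

theorem Trigger.IsOn.mem_vars_out {t : Trigger} {F : FactBase} (h : t.IsOn F) {v : ℕ}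
    (hv : v ∈ FactBase.vars t.out) :
    v ∈ FactBase.vars F ∨ ∃ z ∈ t.rule.exVars, t.freshVar z = v := by
  obtain ⟨b, hb, hvb⟩ := FactBase.mem_vars.1 hv
  obtain ⟨a, ha, rfl⟩ := Finset.mem_image.1 hb
  obtain ⟨s, hs, hsv⟩ := List.mem_map.1 hvb
  cases s with
  | const c => cases hsv
  | var y =>
    change t.ext y = _ at hsv
    by_cases hx : y ∈ t.rule.exVars
    · rw [Trigger.ext_of_mem_exVars hx] at hsv
      exact .inr ⟨y, hx, Term.var.inj hsv⟩
    · have hy : y ∈ FactBase.vars t.rule.body := by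
        by_contra hy
        exact hx (Rule.mem_exVars.2 ⟨FactBase.mem_vars.2 ⟨a, ha, hs⟩, hy⟩)
      rw [Trigger.ext_of_mem_body hy] at hsv
      exact .inl (h.mem_vars hy hsv)

theorem Applicable.not_out_subset {t : Trigger} {F : FactBase} (h : Applicable .R t F) :
    ¬ t.out ⊆ F := fun hs => h ⟨Term.var, by
  refine ⟨fun a ha => ?_, fun _ _ _ => rfl⟩
  rw [Atom.subst_eq_self fun _ _ => rfl]
  simpa [Finset.union_eq_left.2 hs] using ha⟩

theorem applicable_of_forall_not_isHom {t : Trigger} {F : FactBase} (ht : t.IsOn F)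
    (h : ∀ σ : Subst, (∀ v ∈ FactBase.vars t.rule.body, σ v = t.map v) →
      ¬ IsHom σ ↑t.rule.head ↑F) : Applicable .R t F := by
  rintro ⟨σ, hσ, hid⟩
  refine h (fun v => applyTerm σ (t.ext v)) (fun v hv => ?_) fun a ha => ?_
  · rw [Trigger.ext_of_mem_body hv]
    cases hm : t.map v with
    | const c => rfl
    | var u =>
      have hu := ht.mem_vars hv hm
      exact hid u (mem_setVars_coe.2 (FactBase.vars_mono Finset.subset_union_left hu))
        (mem_setVars_coe.2 hu)
  · rw [← Atom.subst_subst]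
    exact hσ _ (Finset.mem_coe.2 (Finset.mem_union_right _ (Finset.mem_image_of_mem _ ha)))

theorem not_applicable_of_isHom {t : Trigger} {F : FactBase} (ht : t.IsOn F)
    (hfresh : ∀ z ∈ t.rule.exVars, t.freshVar z ∉ FactBase.vars F) {σ : Subst}
    (hσ : ∀ v ∈ FactBase.vars t.rule.body, σ v = t.map v) (hh : IsHom σ ↑t.rule.head ↑F) :
    ¬ Applicable .R t F := by
  set τ : Subst := fun v =>
    if h : ∃ z ∈ t.rule.exVars, t.freshVar z = v then σ h.choose else Term.var v with hτ
  have hτF : ∀ v ∈ FactBase.vars F, τ v = Term.var v := by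
    intro v hv
    refine dif_neg ?_
    rintro ⟨z, hz, rfl⟩
    exact hfresh z hz hv
  have hτz : ∀ z ∈ t.rule.exVars, τ (t.freshVar z) = σ z := by
    intro z hz
    have hex : ∃ z' ∈ t.rule.exVars, t.freshVar z' = t.freshVar z := ⟨z, hz, rfl⟩
    rw [hτ]
    simp only [dif_pos hex]
    rw [(Trigger.freshVar_injective hex.choose_spec.2).2.2]
  refine not_not.2 ⟨τ, fun a ha => ?_, fun v _ hv => hτF v (mem_setVars_coe.1 hv)⟩
  rcases Finset.mem_union.1 (Finset.mem_coe.1 ha) with ha | ha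
  · rw [Atom.subst_eq_self fun v hv => hτF v (FactBase.mem_vars.2 ⟨a, ha, hv⟩)]
    exact ha
  · obtain ⟨b, hb, rfl⟩ := Finset.mem_image.1 ha
    rw [Atom.subst_subst, Atom.subst_congr (τ := σ)]
    · exact hh b hb
    intro v hv
    by_cases hx : v ∈ t.rule.exVars
    · rw [Trigger.ext_of_mem_exVars hx]
      exact hτz v hx
    · have hy : v ∈ FactBase.vars t.rule.body := by
        by_contra hy
        exact hx (Rule.mem_exVars.2 ⟨FactBase.mem_vars.2 ⟨b, hb, hv⟩, hy⟩)
      rw [Trigger.ext_of_mem_body hy, hσ v hy]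
      cases hm : t.map v with
      | const c => rfl
      | var u => exact hτF u (ht.mem_vars hy hm)

/-! ### Restricted chase steps -/

/-- One step of the restricted chase. -/
def Step (𝓡 : RuleSet) (F F' : FactBase) : Prop :=
  ∃ t : Trigger, t.rule ∈ 𝓡 ∧ t.IsOn F ∧ Applicable .R t F ∧ F' = F ∪ t.out

/-- Reachability by a finite restricted derivation. -/
abbrev Reach (𝓡 : RuleSet) : FactBase → FactBase → Prop := Relation.ReflTransGen (Step 𝓡)

section Chase

variable {𝓡 : RuleSet} {F F' : FactBase}

theorem Step.subset (h : Step 𝓡 F F') : F ⊆ F' := by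
  obtain ⟨t, -, -, -, rfl⟩ := h
  exact Finset.subset_union_left

/-- `v` is a fresh variable of some trigger whose output is already present in `F`. -/
def Used (𝓡 : RuleSet) (F : FactBase) (v : ℕ) : Prop :=
  ∃ t : Trigger, t.rule ∈ 𝓡 ∧ (∃ z ∈ t.rule.exVars, t.freshVar z = v) ∧ t.out ⊆ F

theorem Used.mono {v : ℕ} (h : Used 𝓡 F v) (hs : F ⊆ F') : Used 𝓡 F' v := by
  obtain ⟨t, h1, h2, h3⟩ := h
  exact ⟨t, h1, h2, h3.trans hs⟩

theorem Applicable.not_used {t : Trigger} (h : Applicable .R t F) (z : ℕ) :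
    ¬ Used 𝓡 F (t.freshVar z) := by
  rintro ⟨t', -, ⟨z', -, hz'⟩, ho⟩
  exact h.not_out_subset (Trigger.out_eq_of_freshVar_eq hz' ▸ ho)

theorem Reach.mem_vars_or_used {F₀ : FactBase} (h : Reach 𝓡 F₀ F) {v : ℕ}
    (hv : v ∈ FactBase.vars F) : v ∈ FactBase.vars F₀ ∨ Used 𝓡 F v := by
  induction h with
  | refl => exact .inl hv
  | @tail G _ _ hs ih =>
    have hsub := hs.subset
    obtain ⟨t, htr, hton, -, rfl⟩ := hs
    have hv' : v ∈ FactBase.vars G ∨ ∃ z ∈ t.rule.exVars, t.freshVar z = v := by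
      obtain ⟨a, ha, hva⟩ := FactBase.mem_vars.1 hv
      rcases Finset.mem_union.1 ha with ha | ha
      · exact .inl (FactBase.mem_vars.2 ⟨a, ha, hva⟩)
      · exact hton.mem_vars_out (FactBase.mem_vars.2 ⟨a, ha, hva⟩)
    rcases hv' with hv' | hz
    · exact (ih hv').imp_right fun h => h.mono hsub
    · exact .inr ⟨t, htr, hz, Finset.subset_union_right⟩

/-- No factbase reachable from `F` has an applicable trigger whose fresh variables clash
with existing variables. -/
def NoClash (𝓡 : RuleSet) (F : FactBase) : Prop :=
  ∀ F', Reach 𝓡 F F' → ∀ t : Trigger, t.rule ∈ 𝓡 → t.IsOn F' → Applicable .R t F' →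
    ∀ z ∈ t.rule.exVars, t.freshVar z ∉ FactBase.vars F'

theorem NoClash.of_reach (h : NoClash 𝓡 F) (hr : Reach 𝓡 F F') : NoClash 𝓡 F' :=
  fun _ hG => h _ (hr.trans hG)

theorem noClash_of_vars_eq_empty (h : FactBase.vars F = ∅) : NoClash 𝓡 F :=
  fun _ hr _ _ _ hta z _ hv => (hr.mem_vars_or_used hv).elim (by simp [h]) (hta.not_used z)

theorem exists_reach_noClash (𝓡 : RuleSet) (F₀ : FactBase) :
    ∃ F, Reach 𝓡 F₀ F ∧ NoClash 𝓡 F := by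
  set μ : FactBase → ℕ := fun F => ((FactBase.vars F₀).filter fun v => ¬ Used 𝓡 F v).card
  obtain ⟨F, hF, hmin⟩ := WellFounded.has_min (measure μ).wf {F | Reach 𝓡 F₀ F}
    ⟨F₀, Relation.ReflTransGen.refl⟩
  refine ⟨F, hF, fun F' hr t htr hton hta z hz hv => ?_⟩
  have hstep : Step 𝓡 F' (F' ∪ t.out) := ⟨t, htr, hton, hta, rfl⟩
  have hsub : F ⊆ F' := by
    clear hton hta hv hstep
    induction hr with
    | refl => exact subset_rfl
    | tail _ hs ih => exact ih.trans hs.subset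
  have hnu := hta.not_used (𝓡 := 𝓡) z
  refine hmin _ ((Relation.ReflTransGen.trans hF hr).tail hstep) (Finset.card_lt_card ?_)
  refine ⟨fun v hv' => ?_, fun hcon => ?_⟩
  · simp only [Finset.mem_filter] at hv' ⊢
    exact ⟨hv'.1, fun hu => hv'.2 (hu.mono (hsub.trans hstep.subset))⟩
  · have hv0 := (Reach.mem_vars_or_used (hF.trans hr) hv).resolve_right hnu
    have := hcon (Finset.mem_filter.2 ⟨hv0, fun hu => hnu (hu.mono hsub)⟩)
    exact (Finset.mem_filter.1 this).2 ⟨t, htr, ⟨z, hz, rfl⟩, Finset.subset_union_right⟩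

/-- `F` has no applicable trigger. -/
def Terminal (𝓡 : RuleSet) (F : FactBase) : Prop :=
  ∀ t : Trigger, t.rule ∈ 𝓡 → t.IsOn F → ¬ Applicable .R t F

theorem NoClash.terminal_of_isModel (h : NoClash 𝓡 F) (hm : IsModelOfRules 𝓡 ↑F) :
    Terminal 𝓡 F := by
  intro t htr hton hta
  obtain ⟨σ, hσ, hh⟩ := hm _ htr t.map hton
  exact not_applicable_of_isHom hton (h F .refl t htr hton hta) hσ hh hta

theorem Reach.exists_derivation (hr : Reach 𝓡 F F') :
    ∃ D : Derivation 𝓡 F, D.IsX .R ∧ ∃ n : ℕ, D.len = n ∧ D.fb n = F' := by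
  suffices h : ∃ (n : ℕ) (fb : ℕ → FactBase) (tr : ℕ → Trigger), fb 0 = F ∧
      (∀ i, n ≤ i → fb i = F') ∧ ∀ i < n, (tr i).rule ∈ 𝓡 ∧ (tr i).IsOn (fb i) ∧
        Applicable .R (tr i) (fb i) ∧ fb (i + 1) = fb i ∪ (tr i).out by
    obtain ⟨n, fb, tr, h0, hn, hi⟩ := h
    refine ⟨⟨n, fb, tr, h0, fun i h => (hi i (by exact_mod_cast h)).1,
      fun i h => (hi i (by exact_mod_cast h)).2.1,
      fun i h => (hi i (by exact_mod_cast h)).2.2.1.not_out_subset,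
      fun i h => (hi i (by exact_mod_cast h)).2.2.2, fun i h => ?_⟩,
      fun i h => (hi i (Nat.cast_lt.1 h)).2.2.1, n, rfl, hn n le_rfl⟩
    have h' : n ≤ i := by exact_mod_cast not_lt.1 h
    rw [hn i h', hn (i + 1) (by omega)]
  induction hr with
  | refl =>
    exact ⟨0, fun _ => F, fun _ => ⟨⟨{⟨0, []⟩}, {⟨0, []⟩}, by simp, by simp⟩, Term.var⟩, rfl,
      fun _ _ => rfl, by simp⟩
  | @tail G G' _ hs ih =>
    obtain ⟨n, fb, tr, h0, hn, hi⟩ := ih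
    obtain ⟨t, htr, hton, hta, rfl⟩ := hs
    refine ⟨n + 1, fun i => if i ≤ n then fb i else G ∪ t.out,
      fun i => if i < n then tr i else t, by simp [h0], fun i h => if_neg (by omega),
      fun i h => ?_⟩
    rcases Nat.lt_succ_iff_lt_or_eq.1 h with h | rfl
    · simpa [h, h.le, Nat.succ_le_of_lt h] using hi i h
    · simp [hn, htr, hton, hta]

theorem ctex_of_reach_terminal (h : ∀ F, ∃ F', Reach 𝓡 F F' ∧ Terminal 𝓡 F') :
    CTex .R 𝓡 := by
  intro F
  obtain ⟨F', hr, ht⟩ := h F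
  obtain ⟨D, hX, n, hlen, hn⟩ := hr.exists_derivation
  refine ⟨D, hX, fun i hi t htr hton hta => ?_, by simp [Derivation.Finite, hlen]⟩
  have hin : i ≤ n := by exact_mod_cast hlen ▸ hi
  rcases hin.lt_or_eq with hlt | rfl
  · refine ⟨n, hlt, hlen.ge, fun hna => ?_⟩
    have hmono : ∀ k, D.fb i ⊆ D.fb (i + k) := by
      intro k
      induction k with
      | zero => exact subset_rfl
      | succ k ih =>
        refine ih.trans ?_
        by_cases hk : ((i + k : ℕ) : ℕ∞) < D.len
        · rw [← add_assoc, D.fb_succ _ hk]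
          exact Finset.subset_union_left
        · rw [← add_assoc, D.fb_stall _ hk]
    have hsub : D.fb i ⊆ D.fb n := by
      simpa [Nat.add_sub_cancel' hlt.le] using hmono (n - i)
    rw [hn] at hna hsub
    exact ht t htr (fun a ha => Finset.mem_coe.2 (hsub (hton a ha))) hna
  · rw [hn] at hton hta
    exact absurd hta (ht t htr hton)

theorem not_ctex_of_reach_not_terminal (F : FactBase)
    (h : ∀ F', Reach 𝓡 F F' → ¬ Terminal 𝓡 F') : ¬ CTex .R 𝓡 := by
  intro hct
  obtain ⟨D, hX, hfair, hfin⟩ := hct F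
  have hreach : ∀ i, Reach 𝓡 F (D.fb i) := by
    intro i
    induction i with
    | zero => rw [D.fb_zero]
    | succ i ih =>
      by_cases hi : (i : ℕ∞) < D.len
      · exact ih.tail ⟨D.tr i, D.rule_mem i hi, D.trig_on i hi, hX i hi, D.fb_succ i hi⟩
      · rwa [D.fb_stall i hi]
  obtain ⟨n, hn⟩ := ENat.ne_top_iff_exists.1 hfin
  refine h _ (hreach n) fun t htr hton hta => ?_
  obtain ⟨j, hj, hjl, -⟩ := hfair n hn.le t htr hton hta
  rw [← hn] at hjl
  exact absurd (Nat.cast_le.1 hjl) (by omega)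

end Chase

/-! ### Pieces -/

theorem mem_spSet {𝓡 : RuleSet} {S : Rule} :
    S ∈ spSet 𝓡 ↔ ∃ R ∈ 𝓡, ∃ a ∈ R.head, S.body = R.body ∧ S.head = pieceOf R a := by
  obtain ⟨body, head, h1, h2⟩ := S
  simp only [spSet, Rule.sp, Finset.mem_biUnion, Finset.mem_image, Finset.mem_attach, true_and,
    Subtype.exists]
  refine exists_congr fun R => and_congr_right fun _ => exists_congr fun a => ?_
  constructor
  · rintro ⟨ha, h⟩
    cases h
    exact ⟨ha, rfl, rfl⟩
  · rintro ⟨ha, rfl, rfl⟩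
    exact ⟨ha, rfl⟩

theorem pieceOf_eq_singleton {R : Rule} {a : Atom} (ha : a ∈ R.head)
    (h : ∀ b, PieceAdj R a b → b = a) : pieceOf R a = {a} := by
  ext b
  simp only [pieceOf, Finset.mem_filter, Finset.mem_singleton]
  constructor
  · rintro ⟨-, hb⟩
    induction hb with
    | refl => rfl
    | tail _ hbc ih => exact h _ (ih ▸ hbc)
  · rintro rfl
    exact ⟨ha, .refl⟩

theorem pieceOf_eq_head {R : Rule} {a : Atom} (h : ∀ b ∈ R.head, b ≠ a → PieceAdj R a b) :
    pieceOf R a = R.head := by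
  refine Finset.filter_true_of_mem fun b hb => ?_
  by_cases hba : b = a
  · exact hba ▸ .refl
  · exact .single (h b hb hba)

/-! ### The rule set -/

/-- The atom `H(s, t)`. -/
def hAtom (s t : Term) : Atom := ⟨0, [s, t]⟩

/-- The atom `Q(s, t)`. -/
def qAtom (s t : Term) : Atom := ⟨1, [s, t]⟩

/-- The atom `D(t)`. -/
def dAtom (t : Term) : Atom := ⟨2, [t]⟩

/-- The atom `B(t)`. -/
def bAtom (t : Term) : Atom := ⟨3, [t]⟩

section Atoms

variable (σ : Subst) (s t s' t' : Term)

@[simp] theorem hAtom_subst :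
    (hAtom s t).subst σ = hAtom (applyTerm σ s) (applyTerm σ t) := rfl
@[simp] theorem qAtom_subst :
    (qAtom s t).subst σ = qAtom (applyTerm σ s) (applyTerm σ t) := rfl
@[simp] theorem dAtom_subst : (dAtom t).subst σ = dAtom (applyTerm σ t) := rfl
@[simp] theorem bAtom_subst : (bAtom t).subst σ = bAtom (applyTerm σ t) := rfl

@[simp] theorem applyTerm_of_var (v : ℕ) : applyTerm σ (Term.var v) = σ v := rfl

@[simp] theorem hAtom_args : (hAtom s t).args = [s, t] := rfl
@[simp] theorem qAtom_args : (qAtom s t).args = [s, t] := rfl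
@[simp] theorem dAtom_args : (dAtom t).args = [t] := rfl
@[simp] theorem bAtom_args : (bAtom t).args = [t] := rfl

@[simp] theorem hAtom_inj : hAtom s t = hAtom s' t' ↔ s = s' ∧ t = t' := by simp [hAtom]
@[simp] theorem qAtom_inj : qAtom s t = qAtom s' t' ↔ s = s' ∧ t = t' := by simp [qAtom]
@[simp] theorem dAtom_inj : dAtom t = dAtom t' ↔ t = t' := by simp [dAtom]
@[simp] theorem bAtom_inj : bAtom t = bAtom t' ↔ t = t' := by simp [bAtom]

@[simp] theorem hAtom_ne_qAtom : hAtom s t ≠ qAtom s' t' := by simp [hAtom, qAtom]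
@[simp] theorem hAtom_ne_dAtom : hAtom s t ≠ dAtom t' := by simp [hAtom, dAtom]
@[simp] theorem hAtom_ne_bAtom : hAtom s t ≠ bAtom t' := by simp [hAtom, bAtom]
@[simp] theorem qAtom_ne_hAtom : qAtom s t ≠ hAtom s' t' := by simp [hAtom, qAtom]
@[simp] theorem qAtom_ne_dAtom : qAtom s t ≠ dAtom t' := by simp [qAtom, dAtom]
@[simp] theorem qAtom_ne_bAtom : qAtom s t ≠ bAtom t' := by simp [qAtom, bAtom]
@[simp] theorem dAtom_ne_hAtom : dAtom t ≠ hAtom s' t' := by simp [hAtom, dAtom]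
@[simp] theorem dAtom_ne_qAtom : dAtom t ≠ qAtom s' t' := by simp [qAtom, dAtom]
@[simp] theorem dAtom_ne_bAtom : dAtom t ≠ bAtom t' := by simp [dAtom, bAtom]
@[simp] theorem bAtom_ne_hAtom : bAtom t ≠ hAtom s' t' := by simp [hAtom, bAtom]
@[simp] theorem bAtom_ne_qAtom : bAtom t ≠ qAtom s' t' := by simp [qAtom, bAtom]
@[simp] theorem bAtom_ne_dAtom : bAtom t ≠ dAtom t' := by simp [dAtom, bAtom]

end Atoms

/-- `H(x, y) → ∃z. H(x, z) ∧ D(y)`, the only rule with two pieces and an existential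
variable. -/
def ruleR : Rule :=
  ⟨{hAtom (.var 0) (.var 1)}, {hAtom (.var 0) (.var 2), dAtom (.var 1)}, by simp, by simp⟩

/-- `H(x, z) → ∃w. Q(z, w)`. -/
def ruleT : Rule :=
  ⟨{hAtom (.var 0) (.var 1)}, {qAtom (.var 1) (.var 2)}, by simp, by simp⟩

/-- `B(z) ∧ Q(z, w) → ∃v. H(w, v) ∧ B(v)`. -/
def ruleG : Rule :=
  ⟨{bAtom (.var 0), qAtom (.var 0) (.var 1)}, {hAtom (.var 1) (.var 2), bAtom (.var 2)},
    by simp, by simp⟩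

/-- `H(x, z) ∧ Q(z, w) ∧ H(x, u) → Q(u, u) ∧ H(u, u) ∧ D(u)`. -/
def ruleC : Rule :=
  ⟨{hAtom (.var 0) (.var 1), qAtom (.var 1) (.var 2), hAtom (.var 0) (.var 3)},
    {qAtom (.var 3) (.var 3), hAtom (.var 3) (.var 3), dAtom (.var 3)}, by simp, by simp⟩

/-- The rule set that sometimes terminates, while its decomposition never does on
`{H(c, d), B(d)}`. -/
def rules : RuleSet := {ruleR, ruleT, ruleG, ruleC}

/-- The piece `H(x, y) → ∃z. H(x, z)` of `ruleR`. -/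
def ruleR₁ : Rule :=
  ⟨{hAtom (.var 0) (.var 1)}, {hAtom (.var 0) (.var 2)}, by simp, by simp⟩

theorem mem_vars_body_ruleR {v : ℕ} : v ∈ FactBase.vars ruleR.body ↔ v = 0 ∨ v = 1 := by
  simp [FactBase.mem_vars, ruleR]

theorem mem_vars_body_ruleR₁ {v : ℕ} : v ∈ FactBase.vars ruleR₁.body ↔ v = 0 ∨ v = 1 := by
  simp [FactBase.mem_vars, ruleR₁]

theorem mem_vars_body_ruleT {v : ℕ} : v ∈ FactBase.vars ruleT.body ↔ v = 0 ∨ v = 1 := by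
  simp [FactBase.mem_vars, ruleT]

theorem mem_vars_body_ruleG {v : ℕ} : v ∈ FactBase.vars ruleG.body ↔ v = 0 ∨ v = 1 := by
  simp [FactBase.mem_vars, ruleG]

theorem mem_vars_body_ruleC {v : ℕ} :
    v ∈ FactBase.vars ruleC.body ↔ v = 0 ∨ v = 1 ∨ v = 2 ∨ v = 3 := by
  simp [FactBase.mem_vars, ruleC]
  tauto

theorem exVars_ruleR : ruleR.exVars = {2} := by
  ext v
  simp only [Rule.mem_exVars, mem_vars_body_ruleR]
  simp [FactBase.mem_vars, ruleR]
  omega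

theorem exVars_ruleT : ruleT.exVars = {2} := by
  ext v
  simp only [Rule.mem_exVars, mem_vars_body_ruleT]
  simp [FactBase.mem_vars, ruleT]
  omega

theorem exVars_ruleG : ruleG.exVars = {2} := by
  ext v
  simp only [Rule.mem_exVars, mem_vars_body_ruleG]
  simp [FactBase.mem_vars, ruleG]
  omega

theorem exVars_ruleC : ruleC.exVars = ∅ := by
  ext v
  simp only [Rule.mem_exVars, mem_vars_body_ruleC]
  simp [FactBase.mem_vars, ruleC]
  omega

section Steps

variable {F : FactBase} {t : Trigger}

theorem out_of_ruleT (h : t.rule = ruleT) :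
    t.out = {qAtom (t.map 1) (.var (t.freshVar 2))} := by
  simp only [Trigger.out, h]
  simp [ruleT, Trigger.ext, h ▸ exVars_ruleT]

theorem out_of_ruleG (h : t.rule = ruleG) :
    t.out = {hAtom (t.map 1) (.var (t.freshVar 2)), bAtom (.var (t.freshVar 2))} := by
  simp only [Trigger.out, h]
  simp [ruleG, Trigger.ext, h ▸ exVars_ruleG]

theorem out_of_ruleR (h : t.rule = ruleR) :
    t.out = {hAtom (t.map 0) (.var (t.freshVar 2)), dAtom (t.map 1)} := by
  simp only [Trigger.out, h]
  simp [ruleR, Trigger.ext, h ▸ exVars_ruleR]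

theorem out_of_ruleC (h : t.rule = ruleC) :
    t.out = {qAtom (t.map 3) (t.map 3), hAtom (t.map 3) (t.map 3), dAtom (t.map 3)} := by
  simp only [Trigger.out, h]
  simp [ruleC, Trigger.ext, h ▸ exVars_ruleC]

theorem isOn_of_ruleT (h : t.rule = ruleT) :
    t.IsOn F ↔ hAtom (t.map 0) (t.map 1) ∈ F := by
  simp [Trigger.IsOn, IsHom, h, ruleT]

theorem isOn_of_ruleG (h : t.rule = ruleG) :
    t.IsOn F ↔ bAtom (t.map 0) ∈ F ∧ qAtom (t.map 0) (t.map 1) ∈ F := by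
  simp [Trigger.IsOn, IsHom, h, ruleG]

theorem isOn_of_ruleR (h : t.rule = ruleR) :
    t.IsOn F ↔ hAtom (t.map 0) (t.map 1) ∈ F := by
  simp [Trigger.IsOn, IsHom, h, ruleR]

theorem isOn_of_body_ruleC (h : t.rule.body = ruleC.body) :
    t.IsOn F ↔ hAtom (t.map 0) (t.map 1) ∈ F ∧ qAtom (t.map 1) (t.map 2) ∈ F ∧
      hAtom (t.map 0) (t.map 3) ∈ F := by
  simp [Trigger.IsOn, IsHom, h, ruleC]

theorem ruleT_applicable (h : t.rule = ruleT) (ht : t.IsOn F)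
    (hn : ∀ w, qAtom (t.map 1) w ∉ F) : Applicable .R t F := by
  refine applicable_of_forall_not_isHom ht fun σ hσ hh => ?_
  have := hσ 1 (by rw [h, mem_vars_body_ruleT]; simp)
  exact hn (σ 2) (by simpa [this] using hh (qAtom (.var 1) (.var 2)) (by simp [h, ruleT]))

theorem ruleG_applicable (h : t.rule = ruleG) (ht : t.IsOn F)
    (hn : ∀ v, ¬ (hAtom (t.map 1) v ∈ F ∧ bAtom v ∈ F)) : Applicable .R t F := by
  refine applicable_of_forall_not_isHom ht fun σ hσ hh => ?_
  have := hσ 1 (by rw [h, mem_vars_body_ruleG]; simp)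
  exact hn (σ 2) ⟨by simpa [this] using hh (hAtom (.var 1) (.var 2)) (by simp [h, ruleG]),
    by simpa using hh (bAtom (.var 2)) (by simp [h, ruleG])⟩

theorem ruleR_applicable (h : t.rule = ruleR) (ht : t.IsOn F)
    (hn : dAtom (t.map 1) ∉ F) : Applicable .R t F := by
  refine applicable_of_forall_not_isHom ht fun σ hσ hh => hn ?_
  have := hσ 1 (by rw [h, mem_vars_body_ruleR]; simp)
  simpa [this] using hh (dAtom (.var 1)) (by simp [h, ruleR])

/-- `z` is closed in `F`: it carries all atoms required of a successor. -/
def Closed (F : FactBase) (z : Term) : Prop :=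
  qAtom z z ∈ F ∧ hAtom z z ∈ F ∧ dAtom z ∈ F

theorem Closed.mono {F' : FactBase} {z : Term} (h : Closed F z) (hs : F ⊆ F') : Closed F' z :=
  ⟨hs h.1, hs h.2.1, hs h.2.2⟩

theorem ruleC_applicable (h : t.rule = ruleC) (ht : t.IsOn F) (hn : ¬ Closed F (t.map 3)) :
    Applicable .R t F := by
  refine applicable_of_forall_not_isHom ht fun σ hσ hh => hn ?_
  have := hσ 3 (by rw [h, mem_vars_body_ruleC]; simp)
  exact ⟨by simpa [this] using hh (qAtom (.var 3) (.var 3)) (by simp [h, ruleC]),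
    by simpa [this] using hh (hAtom (.var 3) (.var 3)) (by simp [h, ruleC]),
    by simpa [this] using hh (dAtom (.var 3)) (by simp [h, ruleC])⟩

theorem exists_step_ruleT {x z : Term} (hx : hAtom x z ∈ F) (hn : ∀ w, qAtom z w ∉ F) :
    ∃ u, Step rules F (F ∪ {qAtom z u}) := by
  set t : Trigger := ⟨ruleT, fun n => [x, z].getD n x⟩
  have ht : t.IsOn F := (isOn_of_ruleT rfl).2 (by simpa [t] using hx)
  refine ⟨.var (t.freshVar 2), t, by simp [t, rules], ht, ruleT_applicable rfl ht (by simpa [t] using hn), ?_⟩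
  rw [out_of_ruleT rfl]
  simp [t]

theorem step_ruleC {x z w z' : Term} (h1 : hAtom x z ∈ F) (h2 : qAtom z w ∈ F)
    (h3 : hAtom x z' ∈ F) (hn : ¬ Closed F z') :
    Step rules F (F ∪ {qAtom z' z', hAtom z' z', dAtom z'}) := by
  set t : Trigger := ⟨ruleC, fun n => [x, z, w, z'].getD n x⟩
  have ht : t.IsOn F := (isOn_of_body_ruleC rfl).2 (by simpa [t] using ⟨h1, h2, h3⟩)
  refine ⟨t, by simp [t, rules], ht, ruleC_applicable rfl ht (by simpa [t] using hn), ?_⟩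
  rw [out_of_ruleC rfl]
  simp [t]

theorem exists_step_ruleG (hF : NoClash rules F) {z w : Term} (h1 : bAtom z ∈ F)
    (h2 : qAtom z w ∈ F) (hn : ∀ v, ¬ (hAtom w v ∈ F ∧ bAtom v ∈ F)) :
    ∃ v ∉ FactBase.vars F, Step rules F (F ∪ {hAtom w (.var v), bAtom (.var v)}) := by
  set t : Trigger := ⟨ruleG, fun n => [z, w].getD n z⟩
  have ht : t.IsOn F := (isOn_of_ruleG rfl).2 (by simpa [t] using ⟨h1, h2⟩)
  have ha : Applicable .R t F := ruleG_applicable rfl ht (by simpa [t] using hn)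
  refine ⟨t.freshVar 2, hF F .refl t (by simp [t, rules]) ht ha 2 (by simp [t, exVars_ruleG]),
    t, by simp [t, rules], ht, ha, ?_⟩
  rw [out_of_ruleG rfl]
  simp [t]

theorem exists_step_ruleR (hF : NoClash rules F) {x y : Term} (h1 : hAtom x y ∈ F)
    (hn : dAtom y ∉ F) :
    ∃ z ∉ FactBase.vars F, Step rules F (F ∪ {hAtom x (.var z), dAtom y}) := by
  set t : Trigger := ⟨ruleR, fun n => [x, y].getD n x⟩
  have ht : t.IsOn F := (isOn_of_ruleR rfl).2 (by simpa [t] using h1)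
  have ha : Applicable .R t F := ruleR_applicable rfl ht (by simpa [t] using hn)
  refine ⟨t.freshVar 2, hF F .refl t (by simp [t, rules]) ht ha 2 (by simp [t, exVars_ruleR]),
    t, by simp [t, rules], ht, ha, ?_⟩
  rw [out_of_ruleR rfl]
  simp [t]

end Steps

/-! ### Termination for the undecomposed rule set -/

section Termination

variable {F : FactBase}

/-- The terms occurring in a factbase. -/
def termsIn (F : FactBase) : Finset Term := F.biUnion fun a => a.args.toFinset

theorem mem_termsIn {t : Term} : t ∈ termsIn F ↔ ∃ a ∈ F, t ∈ a.args := by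
  simp [termsIn]

/-- Every `H`-successor is closed. -/
def AllClosed (F : FactBase) : Prop := ∀ x z, hAtom x z ∈ F → Closed F z

/-- The `H`-successors that are not closed. -/
def unclosed (F : FactBase) : Finset Term :=
  (termsIn F).filter fun z => (∃ x, hAtom x z ∈ F) ∧ ¬ Closed F z

theorem mem_unclosed {z : Term} :
    z ∈ unclosed F ↔ (∃ x, hAtom x z ∈ F) ∧ ¬ Closed F z := by
  simp only [unclosed, Finset.mem_filter, mem_termsIn, and_iff_right_iff_imp]
  rintro ⟨⟨x, hx⟩, -⟩
  exact ⟨_, hx, by simp⟩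

theorem exists_reach_closed {x z : Term} (hx : hAtom x z ∈ F) (hz : ¬ Closed F z) :
    ∃ F', Reach rules F F' ∧ F ⊆ F' ∧ Closed F' z ∧
      ∀ a b, hAtom a b ∈ F' → b = z ∨ hAtom a b ∈ F := by
  by_cases hq : ∃ w, qAtom z w ∈ F
  · obtain ⟨w, hw⟩ := hq
    refine ⟨_, .single (step_ruleC hx hw hx hz), Finset.subset_union_left,
      by simp [Closed], fun a b hab => ?_⟩
    simp at hab
    tauto
  · push Not at hq
    obtain ⟨u, hu⟩ := exists_step_ruleT hx hq
    by_cases hz' : Closed (F ∪ {qAtom z u}) z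
    · exact ⟨_, .single hu, hu.subset, hz', fun a b hab => .inr (by simpa using hab)⟩
    · have hs := step_ruleC (hu.subset hx) (by simp : qAtom z u ∈ _) (hu.subset hx) hz'
      refine ⟨_, .tail (.single hu) hs, hu.subset.trans hs.subset,
        by simp [Closed], fun a b hab => ?_⟩
      simp at hab
      tauto

theorem exists_reach_allClosed (F : FactBase) : ∃ F', Reach rules F F' ∧ AllClosed F' := by
  induction hn : (unclosed F).card using Nat.strong_induction_on generalizing F with
  | _ n ih =>
  subst hn
  by_cases hc : AllClosed F
  · exact ⟨F, .refl, hc⟩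
  simp only [AllClosed, not_forall] at hc
  obtain ⟨x, z, hx, hz⟩ := hc
  obtain ⟨F₁, hr, hsub, hcl, hH⟩ := exists_reach_closed hx hz
  have hlt : unclosed F₁ ⊂ unclosed F := by
    refine ⟨fun y hy => ?_, fun hcon => ?_⟩
    · obtain ⟨⟨a, ha⟩, hy⟩ := mem_unclosed.1 hy
      refine mem_unclosed.2 ⟨?_, fun h => hy (h.mono hsub)⟩
      rcases hH a y ha with rfl | h
      exacts [⟨x, hx⟩, ⟨a, h⟩]
    · exact (mem_unclosed.1 (hcon (mem_unclosed.2 ⟨⟨x, hx⟩, hz⟩))).2 hcl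
  obtain ⟨F₂, hr', h2⟩ := ih _ (Finset.card_lt_card hlt) F₁ rfl
  exact ⟨F₂, hr.trans hr', h2⟩

/-- The terms on which `ruleG` is not satisfied. -/
def pending (F : FactBase) : Finset Term :=
  (termsIn F).filter fun w =>
    (∃ z, bAtom z ∈ F ∧ qAtom z w ∈ F) ∧ ∀ v, ¬ (hAtom w v ∈ F ∧ bAtom v ∈ F)

theorem mem_pending {w : Term} :
    w ∈ pending F ↔
      (∃ z, bAtom z ∈ F ∧ qAtom z w ∈ F) ∧ ∀ v, ¬ (hAtom w v ∈ F ∧ bAtom v ∈ F) := by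
  simp only [pending, Finset.mem_filter, mem_termsIn, and_iff_right_iff_imp]
  rintro ⟨⟨z, -, hz⟩, -⟩
  exact ⟨_, hz, by simp⟩

theorem not_mem_args_of_fresh {v : ℕ} (hv : v ∉ FactBase.vars F) {a : Atom} (ha : a ∈ F) :
    Term.var v ∉ a.args := fun h => hv (FactBase.mem_vars.2 ⟨a, ha, h⟩)

theorem exists_reach_pending_ssubset (hF : NoClash rules F) (hc : AllClosed F) {w : Term}
    (hw : w ∈ pending F) :
    ∃ F', Reach rules F F' ∧ AllClosed F' ∧ pending F' ⊂ pending F := by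
  obtain ⟨⟨y, hy, hyw⟩, hn⟩ := mem_pending.1 hw
  obtain ⟨v, hv, s₁⟩ := exists_step_ruleG hF hy hyw hn
  have hvF : ∀ a ∈ F, Term.var v ∉ a.args := fun a => not_mem_args_of_fresh hv
  set F₁ := F ∪ {hAtom w (.var v), bAtom (.var v)} with hF₁
  have hD : dAtom (.var v) ∉ F₁ := by
    simpa [hF₁] using fun h => hvF _ h (by simp)
  obtain ⟨z, hz, s₂⟩ := exists_step_ruleR (hF.of_reach (.single s₁)) (x := w) (y := .var v)
    (by simp [hF₁]) hD
  have hzF₁ : ∀ a ∈ F₁, Term.var z ∉ a.args := fun a => not_mem_args_of_fresh hz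
  have hzF : ∀ a ∈ F, Term.var z ∉ a.args := fun a ha => hzF₁ a (s₁.subset ha)
  have hzv : z ≠ v := by
    rintro rfl
    exact hzF₁ (bAtom (.var z)) (by simp [hF₁]) (by simp)
  have hQv : ∀ u, qAtom (.var v) u ∉ F := fun u h => hvF _ h (by simp)
  have hQz : ∀ u, qAtom (.var z) u ∉ F := fun u h => hzF _ h (by simp)
  set F₂ := F₁ ∪ {hAtom w (.var z), dAtom (.var v)} with hF₂
  obtain ⟨u, s₃⟩ := exists_step_ruleT (F := F₂) (x := w) (z := .var z) (by simp [hF₂])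
    (by simpa [hF₂, hF₁] using hQz)
  set F₃ := F₂ ∪ {qAtom (.var z) u} with hF₃
  have s₄ := step_ruleC (F := F₃) (x := w) (z := .var z) (w := u) (z' := .var v)
    (by simp [hF₃, hF₂]) (by simp [hF₃]) (by simp [hF₃, hF₂, hF₁])
    (fun h => by simpa [hF₃, hF₂, hF₁, hQv, hzv.symm] using h.1)
  set F₄ := F₃ ∪ {qAtom (.var v) (.var v), hAtom (.var v) (.var v), dAtom (.var v)} with hF₄
  have s₅ := step_ruleC (F := F₄) (x := w) (z := .var z) (w := u) (z' := .var z)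
    (by simp [hF₄, hF₃, hF₂]) (by simp [hF₄, hF₃]) (by simp [hF₄, hF₃, hF₂, hF₁])
    (fun h => hzF (dAtom (.var z)) (by simpa [hF₄, hF₃, hF₂, hF₁, hzv] using h.2.2) (by simp))
  set F₅ := F₄ ∪ {qAtom (.var z) (.var z), hAtom (.var z) (.var z), dAtom (.var z)} with hF₅
  have hsub : F ⊆ F₅ := s₁.subset.trans <| s₂.subset.trans <| s₃.subset.trans <|
    s₄.subset.trans s₅.subset
  refine ⟨F₅, .tail (.tail (.tail (.tail (.single s₁) s₂) s₃) s₄) s₅, fun a b hab => ?_, ?_⟩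
  · by_cases hb : hAtom a b ∈ F
    · exact (hc _ _ hb).mono hsub
    · have : b = .var v ∨ b = .var z := by
        simp [hF₅, hF₄, hF₃, hF₂, hF₁, hb] at hab
        tauto
      rcases this with rfl | rfl <;> simp [Closed, hF₅, hF₄]
  · refine ⟨fun w' hw' => ?_, fun hcon => ?_⟩
    · obtain ⟨⟨y', hb, hq⟩, hn'⟩ := mem_pending.1 hw'
      refine mem_pending.2 ⟨⟨y', ?_⟩, fun v' h => hn' v' ⟨hsub h.1, hsub h.2⟩⟩
      have hb' : y' = .var v ∨ bAtom y' ∈ F := by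
        simpa [hF₅, hF₄, hF₃, hF₂, hF₁] using hb
      rcases hb' with rfl | hb'
      · have : w' = .var v := by
          simpa [hF₅, hF₄, hF₃, hF₂, hF₁, hQv, hzv.symm] using hq
        subst this
        exact absurd ⟨by simp [hF₅, hF₄], hb⟩ (hn' (.var v))
      · have hyz : y' ≠ .var z := by
          rintro rfl
          exact hzF _ hb' (by simp)
        have hyv : y' ≠ .var v := by
          rintro rfl
          exact hvF _ hb' (by simp)
        exact ⟨hb', by simpa [hF₅, hF₄, hF₃, hF₂, hF₁, hyz, hyv] using hq⟩
    · exact (mem_pending.1 (hcon hw)).2 (.var v)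
        ⟨by simp [hF₅, hF₄, hF₃, hF₂, hF₁], by simp [hF₅, hF₄, hF₃, hF₂, hF₁]⟩

theorem exists_reach_pending_eq_empty (hF : NoClash rules F) (hc : AllClosed F) :
    ∃ F', Reach rules F F' ∧ AllClosed F' ∧ pending F' = ∅ := by
  induction hn : (pending F).card using Nat.strong_induction_on generalizing F with
  | _ n ih =>
  subst hn
  rcases (pending F).eq_empty_or_nonempty with he | ⟨w, hw⟩
  · exact ⟨F, .refl, hc, he⟩
  obtain ⟨F₁, hr, hc₁, hss⟩ := exists_reach_pending_ssubset hF hc hw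
  obtain ⟨F₂, hr', h⟩ := ih _ (Finset.card_lt_card hss) (hF.of_reach hr) hc₁ rfl
  exact ⟨F₂, hr.trans hr', h⟩

theorem isModelOfRules_of_allClosed (hc : AllClosed F) (hp : pending F = ∅) :
    IsModelOfRules rules ↑F := by
  intro R hR
  simp only [rules, Finset.mem_insert, Finset.mem_singleton] at hR
  rcases hR with rfl | rfl | rfl | rfl <;> intro σ hσ
  · have h : hAtom (σ 0) (σ 1) ∈ F := by simpa [IsHom, ruleR] using hσ
    refine ⟨Function.update σ 2 (σ 1), fun v hv => ?_, ?_⟩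
    · rcases mem_vars_body_ruleR.1 hv with rfl | rfl <;> simp
    · simpa [IsHom, ruleR] using ⟨h, (hc _ _ h).2.2⟩
  · have h : hAtom (σ 0) (σ 1) ∈ F := by simpa [IsHom, ruleT] using hσ
    refine ⟨Function.update σ 2 (σ 1), fun v hv => ?_, ?_⟩
    · rcases mem_vars_body_ruleT.1 hv with rfl | rfl <;> simp
    · simpa [IsHom, ruleT] using (hc _ _ h).1
  · have h : bAtom (σ 0) ∈ F ∧ qAtom (σ 0) (σ 1) ∈ F := by simpa [IsHom, ruleG] using hσ
    obtain ⟨u, hu⟩ : ∃ u, hAtom (σ 1) u ∈ F ∧ bAtom u ∈ F := by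
      by_contra! hcon
      have := mem_pending.2 ⟨⟨_, h⟩, fun v hv => hcon v hv.1 hv.2⟩
      simp [hp] at this
    refine ⟨Function.update σ 2 u, fun v hv => ?_, ?_⟩
    · rcases mem_vars_body_ruleG.1 hv with rfl | rfl <;> simp
    · simpa [IsHom, ruleG] using hu
  · have h : hAtom (σ 0) (σ 1) ∈ F ∧ qAtom (σ 1) (σ 2) ∈ F ∧ hAtom (σ 0) (σ 3) ∈ F := by
      simpa [IsHom, ruleC] using hσ
    exact ⟨σ, fun _ _ => rfl, by simpa [IsHom, ruleC, Closed] using hc _ _ h.2.2⟩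

theorem ctex_rules : CTex .R rules := by
  refine ctex_of_reach_terminal fun F => ?_
  obtain ⟨F₁, h₁, hnc⟩ := exists_reach_noClash rules F
  obtain ⟨F₂, h₂, hc⟩ := exists_reach_allClosed F₁
  obtain ⟨F₃, h₃, hc', hp⟩ := exists_reach_pending_eq_empty (hnc.of_reach h₂) hc
  exact ⟨F₃, (h₁.trans h₂).trans h₃, ((hnc.of_reach h₂).of_reach h₃).terminal_of_isModel
    (isModelOfRules_of_allClosed hc' hp)⟩

end Termination

/-! ### Non-termination for the decomposed rule set -/

section NonTermination

variable {F : FactBase} {t : Trigger}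

theorem pieceOf_ruleR_hAtom :
    pieceOf ruleR (hAtom (.var 0) (.var 2)) = {hAtom (.var 0) (.var 2)} := by
  refine pieceOf_eq_singleton (by simp [ruleR]) fun b hb => ?_
  obtain ⟨-, hb, v, hv⟩ := hb
  simp only [Finset.mem_inter, Atom.mem_vars, exVars_ruleR, Finset.mem_singleton] at hv
  obtain ⟨⟨-, hvb⟩, rfl⟩ := hv
  simp only [ruleR, Finset.mem_insert, Finset.mem_singleton] at hb
  rcases hb with rfl | rfl
  · rfl
  · simp at hvb

theorem pieceOf_ruleR_dAtom : pieceOf ruleR (dAtom (.var 1)) = {dAtom (.var 1)} := by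
  refine pieceOf_eq_singleton (by simp [ruleR]) fun b hb => ?_
  obtain ⟨-, -, v, hv⟩ := hb
  simp only [Finset.mem_inter, Atom.mem_vars, exVars_ruleR, Finset.mem_singleton] at hv
  obtain ⟨⟨hva, -⟩, rfl⟩ := hv
  simp at hva

theorem pieceOf_ruleG {a : Atom} (ha : a ∈ ruleG.head) : pieceOf ruleG a = ruleG.head := by
  have h2 : ∀ b ∈ ruleG.head, 2 ∈ b.vars := by simp [ruleG, Atom.mem_vars]
  exact pieceOf_eq_head fun b hb _ => ⟨ha, hb, 2, by simp [h2 a ha, h2 b hb, exVars_ruleG]⟩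

theorem Rule.eq_of_eq {R S : Rule} (h1 : R.body = S.body) (h2 : R.head = S.head) : R = S := by
  cases R
  cases S
  simp_all

theorem mem_spSet_rules {S : Rule} (h : S ∈ spSet rules) :
    S = ruleR₁ ∨ (S.body = ruleR.body ∧ S.head = {dAtom (.var 1)}) ∨ S = ruleT ∨ S = ruleG ∨
      (S.body = ruleC.body ∧ S.head ⊆ ruleC.head) := by
  obtain ⟨R, hR, a, ha, hb, hh⟩ := mem_spSet.1 h
  simp only [rules, Finset.mem_insert, Finset.mem_singleton] at hR
  rcases hR with rfl | rfl | rfl | rfl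
  · simp only [ruleR, Finset.mem_insert, Finset.mem_singleton] at ha
    rcases ha with rfl | rfl
    · exact .inl (Rule.eq_of_eq hb (hh.trans pieceOf_ruleR_hAtom))
    · exact .inr (.inl ⟨hb, hh.trans pieceOf_ruleR_dAtom⟩)
  · refine .inr (.inr (.inl (Rule.eq_of_eq hb ?_)))
    obtain rfl := Finset.mem_singleton.1 ha
    exact hh.trans (pieceOf_eq_head fun b hb hne => absurd (Finset.mem_singleton.1 hb) hne)
  · exact .inr (.inr (.inr (.inl (Rule.eq_of_eq hb (hh.trans (pieceOf_ruleG ha))))))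
  · exact .inr (.inr (.inr (.inr ⟨hb, hh ▸ Finset.filter_subset _ _⟩)))

theorem ruleT_mem_spSet : ruleT ∈ spSet rules :=
  mem_spSet.2 ⟨ruleT, by simp [rules], _, Finset.mem_singleton_self _, rfl,
    (pieceOf_eq_head fun _ hb hne => absurd (Finset.mem_singleton.1 hb) hne).symm⟩

theorem ruleG_mem_spSet : ruleG ∈ spSet rules :=
  mem_spSet.2 ⟨ruleG, by simp [rules], bAtom (.var 2), by simp [ruleG], rfl,
    (pieceOf_ruleG (by simp [ruleG])).symm⟩

/-- `v` is the unique `H`-successor of `x`, marked by `B`, and still needs a `Q`-successor. -/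
structure NeedsQ (F : FactBase) (x v : Term) : Prop where
  edge : hAtom x v ∈ F
  mark : bAtom v ∈ F
  pred_unique : ∀ y, hAtom y v ∈ F → y = x
  succ_unique : ∀ y, hAtom x y ∈ F → y = v
  no_pred : ∀ y, hAtom y x ∉ F
  no_q : ∀ w, qAtom v w ∉ F

/-- `w` is a `Q`-successor of the marked term `z` and still needs an `H`-successor. -/
structure NeedsH (F : FactBase) (z w : Term) : Prop where
  mark : bAtom z ∈ F
  edge : qAtom z w ∈ F
  no_succ : ∀ y, hAtom w y ∉ F
  no_pred : ∀ y, hAtom y w ∉ F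

theorem NeedsQ.union {x v : Term} {S : FactBase} (h : NeedsQ F x v)
    (hH : ∀ a b, hAtom a b ∈ S → b ≠ v ∧ a ≠ x ∧ b ≠ x) (hQ : ∀ b, qAtom v b ∉ S) :
    NeedsQ (F ∪ S) x v where
  edge := Finset.mem_union_left _ h.edge
  mark := Finset.mem_union_left _ h.mark
  pred_unique y hy := (Finset.mem_union.1 hy).elim (h.pred_unique y)
    fun hy => absurd rfl (hH _ _ hy).1
  succ_unique y hy := (Finset.mem_union.1 hy).elim (h.succ_unique y)
    fun hy => absurd rfl (hH _ _ hy).2.1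
  no_pred y hy := (Finset.mem_union.1 hy).elim (h.no_pred y)
    fun hy => absurd rfl (hH _ _ hy).2.2
  no_q w hw := (Finset.mem_union.1 hw).elim (h.no_q w) (hQ w)

theorem NeedsH.union {z w : Term} {S : FactBase} (h : NeedsH F z w)
    (hH : ∀ a b, hAtom a b ∈ S → a ≠ w ∧ b ≠ w) : NeedsH (F ∪ S) z w where
  mark := Finset.mem_union_left _ h.mark
  edge := Finset.mem_union_left _ h.edge
  no_succ y hy := (Finset.mem_union.1 hy).elim (h.no_succ y) fun hy => absurd rfl (hH _ _ hy).1
  no_pred y hy := (Finset.mem_union.1 hy).elim (h.no_pred y) fun hy => absurd rfl (hH _ _ hy).2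

/-- The invariant of the chase with the decomposed rules. -/
def HasTip (F : FactBase) : Prop := (∃ x v, NeedsQ F x v) ∨ ∃ z w, NeedsH F z w

theorem not_applicable_of_ruleR₁ (h : t.rule = ruleR₁) (ht : t.IsOn F)
    (hfresh : ∀ z ∈ t.rule.exVars, t.freshVar z ∉ FactBase.vars F) : ¬ Applicable .R t F := by
  have hH : hAtom (t.map 0) (t.map 1) ∈ F := by
    simpa [Trigger.IsOn, IsHom, h, ruleR₁] using ht
  refine not_applicable_of_isHom ht hfresh (σ := Function.update t.map 2 (t.map 1))
    (fun v hv => ?_) ?_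
  · rw [h, mem_vars_body_ruleR₁] at hv
    rcases hv with rfl | rfl <;> simp
  · simpa [IsHom, h, ruleR₁] using hH

theorem not_applicable_of_ruleG (h : t.rule = ruleG) (ht : t.IsOn F)
    (hfresh : ∀ z ∈ t.rule.exVars, t.freshVar z ∉ FactBase.vars F) {v : Term}
    (h1 : hAtom (t.map 1) v ∈ F) (h2 : bAtom v ∈ F) : ¬ Applicable .R t F := by
  refine not_applicable_of_isHom ht hfresh (σ := Function.update t.map 2 v)
    (fun u hu => ?_) ?_
  · rw [h, mem_vars_body_ruleG] at hu
    rcases hu with rfl | rfl <;> simp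
  · simpa [IsHom, h, ruleG] using ⟨h1, h2⟩

theorem out_subset_of_ruleC (h1 : t.rule.body = ruleC.body) (h2 : t.rule.head ⊆ ruleC.head) :
    t.out ⊆ {qAtom (t.map 3) (t.map 3), hAtom (t.map 3) (t.map 3), dAtom (t.map 3)} := by
  have h3 : t.ext 3 = t.map 3 :=
    Trigger.ext_of_mem_body (by rw [h1, mem_vars_body_ruleC]; simp)
  refine (Finset.image_subset_image h2).trans ?_
  simp [ruleC, h3, Finset.image_insert]

theorem HasTip.union_out_of_ruleT (hF : HasTip F) (h : t.rule = ruleT)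
    (hfresh : t.freshVar 2 ∉ FactBase.vars F) : HasTip (F ∪ t.out) := by
  have hu : ∀ a ∈ F, Term.var (t.freshVar 2) ∉ a.args := fun a => not_mem_args_of_fresh hfresh
  rw [out_of_ruleT h]
  rcases hF with ⟨x, v, hq⟩ | ⟨z, w, hh⟩
  · by_cases hv : t.map 1 = v
    · refine .inr ⟨v, .var (t.freshVar 2), ⟨Finset.mem_union_left _ hq.mark, by simp [hv],
        fun y hy => ?_, fun y hy => ?_⟩⟩
      · exact hu _ (by simpa using hy) (by simp)
      · exact hu _ (by simpa using hy) (by simp)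
    · exact .inl ⟨x, v, hq.union (by simp) (by simp [Ne.symm hv])⟩
  · exact .inr ⟨z, w, hh.union (by simp)⟩

theorem HasTip.union_out_of_ruleG (hF : HasTip F) (h : t.rule = ruleG) (ht : t.IsOn F)
    (hta : Applicable .R t F)
    (hfresh : ∀ z ∈ t.rule.exVars, t.freshVar z ∉ FactBase.vars F) : HasTip (F ∪ t.out) := by
  have hu : ∀ a ∈ F, Term.var (t.freshVar 2) ∉ a.args := fun a =>
    not_mem_args_of_fresh (hfresh 2 (by simp [h, exVars_ruleG]))
  have hon := (isOn_of_ruleG h).1 ht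
  rw [out_of_ruleG h]
  rcases hF with ⟨x, v, hq⟩ | ⟨z, w, hh⟩
  · refine .inl ⟨x, v, hq.union (fun a b hab => ?_) (by simp)⟩
    obtain ⟨rfl, rfl⟩ : a = t.map 1 ∧ b = .var (t.freshVar 2) := by simpa using hab
    refine ⟨?_, ?_, ?_⟩
    · rintro rfl
      exact hu _ hq.edge (by simp)
    · rintro rfl
      exact not_applicable_of_ruleG h ht hfresh hq.edge hq.mark hta
    · rintro rfl
      exact hu _ hq.edge (by simp)
  · have hw : Term.var (t.freshVar 2) ≠ w := by
      rintro rfl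
      exact hu _ hh.edge (by simp)
    by_cases hw' : t.map 1 = w
    · refine .inl ⟨w, .var (t.freshVar 2), by simp [hw'], by simp, fun y hy => ?_, fun y hy => ?_,
        fun y hy => ?_, fun y hy => ?_⟩
      · have : y = w ∨ hAtom y (.var (t.freshVar 2)) ∈ F := by simpa [hw'] using hy
        exact this.resolve_right fun hy => hu _ hy (by simp)
      · simpa [hw', hh.no_succ] using hy
      · simp [hh.no_pred, hw.symm] at hy
      · exact hu _ (by simpa using hy) (by simp)
    · refine .inr ⟨z, w, hh.union fun a b hab => ?_⟩
      obtain ⟨rfl, rfl⟩ : a = t.map 1 ∧ b = .var (t.freshVar 2) := by simpa using hab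
      exact ⟨hw', hw⟩

theorem HasTip.union_out_of_ruleC (hF : HasTip F) (h1 : t.rule.body = ruleC.body)
    (h2 : t.rule.head ⊆ ruleC.head) (ht : t.IsOn F) : HasTip (F ∪ t.out) := by
  obtain ⟨ha, hb, hc⟩ := (isOn_of_body_ruleC h1).1 ht
  have hH : ∀ a b, hAtom a b ∈ t.out → a = t.map 3 ∧ b = t.map 3 := fun a b hab => by
    simpa using out_subset_of_ruleC h1 h2 hab
  have hQ : ∀ a b, qAtom a b ∈ t.out → a = t.map 3 ∧ b = t.map 3 := fun a b hab => by
    simpa using out_subset_of_ruleC h1 h2 hab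
  rcases hF with ⟨x, v, hq⟩ | ⟨z, w, hh⟩
  · have hv : t.map 3 ≠ v := by
      rintro rfl
      rw [hq.pred_unique _ hc] at ha
      rw [hq.succ_unique _ ha] at hb
      exact hq.no_q _ hb
    have hx : t.map 3 ≠ x := by
      rintro rfl
      exact hq.no_pred _ hc
    refine .inl ⟨x, v, hq.union (fun a b hab => ?_) fun b hb => ?_⟩
    · obtain ⟨rfl, rfl⟩ := hH a b hab
      exact ⟨hv, hx, hx⟩
    · exact hv (hQ _ _ hb).1.symm
  · have hw : t.map 3 ≠ w := by
      rintro rfl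
      exact hh.no_pred _ hc
    refine .inr ⟨z, w, hh.union fun a b hab => ?_⟩
    obtain ⟨rfl, rfl⟩ := hH a b hab
    exact ⟨hw, hw⟩

theorem HasTip.union_out_of_dAtom (hF : HasTip F) {s : Term}
    (h : t.out = {dAtom s}) : HasTip (F ∪ t.out) := by
  rw [h]
  rcases hF with ⟨x, v, hq⟩ | ⟨z, w, hh⟩
  · exact .inl ⟨x, v, hq.union (by simp) (by simp)⟩
  · exact .inr ⟨z, w, hh.union (by simp)⟩

theorem HasTip.not_terminal (hF : HasTip F) : ¬ Terminal (spSet rules) F := by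
  intro hterm
  rcases hF with ⟨x, v, hq⟩ | ⟨z, w, hh⟩
  · set t : Trigger := ⟨ruleT, fun n => [x, v].getD n x⟩
    have ht : t.IsOn F := (isOn_of_ruleT rfl).2 (by simpa [t] using hq.edge)
    exact hterm t ruleT_mem_spSet ht (ruleT_applicable rfl ht (by simpa [t] using hq.no_q))
  · set t : Trigger := ⟨ruleG, fun n => [z, w].getD n z⟩
    have ht : t.IsOn F := (isOn_of_ruleG rfl).2 (by simpa [t] using ⟨hh.mark, hh.edge⟩)
    exact hterm t ruleG_mem_spSet ht
      (ruleG_applicable rfl ht (by simp [t, hh.no_succ]))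

/-- The factbase `{H(c, d), B(d)}`. -/
def startBase : FactBase := {hAtom (.const 0) (.const 1), bAtom (.const 1)}

theorem hasTip_of_reach (h : Reach (spSet rules) startBase F) : HasTip F := by
  have hnc : NoClash (spSet rules) startBase := noClash_of_vars_eq_empty <| by
    ext v
    simp [FactBase.mem_vars, startBase]
  induction h with
  | refl =>
    exact .inl ⟨.const 0, .const 1, by constructor <;> simp [startBase]⟩
  | @tail G _ hr hs ih =>
    obtain ⟨t, htr, ht, hta, rfl⟩ := hs
    have hfresh := hnc G hr t htr ht hta
    rcases mem_spSet_rules htr with h | ⟨h1, h2⟩ | h | h | ⟨h1, h2⟩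
    · exact absurd hta (not_applicable_of_ruleR₁ h ht hfresh)
    · exact ih.union_out_of_dAtom (by simp [Trigger.out, h2]; rfl)
    · exact ih.union_out_of_ruleT h (hfresh 2 (by simp [h, exVars_ruleT]))
    · exact ih.union_out_of_ruleG h ht hta hfresh
    · exact ih.union_out_of_ruleC h1 h2 ht

theorem not_ctex_spSet_rules : ¬ CTex .R (spSet rules) :=
  not_ctex_of_reach_not_terminal startBase fun _ h => (hasTip_of_reach h).not_terminal

end NonTermination

/-- The single-piece decomposition does not preserve
sometimes-termination of the restricted chase. -/
theorem statement5 : ∃ 𝓡 : RuleSet, CTex Variant.R 𝓡 ∧ ¬ CTex Variant.R (spSet 𝓡) :=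
  ⟨rules, ctex_rules, not_ctex_spSet_rules⟩

end
end ExRules
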